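/- Let n ≥ 2. There exist constants c, C > 0, depending only on n, such that for every integer k ≥ 1 the normalization constant c_k = (∫_{Sⁿ} (Re((x₁ + i x₂)^k))² dσ(x))^{−1/2}, which makes the highest weight spherical harmonic Q_k = c_k · Re((x₁ + i x₂)^k) have L²(Sⁿ)-norm one, satisfies c · k^{(n−1)/4} ≤ c_k ≤ C · k^{(n−1)/4}. -/

import Mathlib

open MeasureTheory Complex

open Set in
/-- Polar integration of a positively homogeneous function against the Gaussian weight. -/
theorem integral_homogeneous_mul_exp_neg_sq {E : Type*} [NormedAddCommGroup E] [NormedSpace ℝ E]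
    [FiniteDimensional ℝ E] [Nontrivial E] [MeasurableSpace E] [BorelSpace E]
    (μ : Measure E) [μ.IsAddHaarMeasure] (f : E → ℝ) (q : ℕ)
    (hf : ∀ r : ℝ, 0 < r → ∀ x, f (r • x) = r ^ q * f x) :
    ∫ x, f x * Real.exp (-‖x‖ ^ 2) ∂μ =
      (∫ x : Metric.sphere (0 : E) 1, f x ∂μ.toSphere) *
        (Real.Gamma ((Module.finrank ℝ E + q : ℝ) / 2) / 2) := by
  set d := Module.finrank ℝ E
  have hd0 : 0 < d := Module.finrank_pos
  calc
    ∫ x, f x * Real.exp (-‖x‖ ^ 2) ∂μ =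
        ∫ x : ({(0)}ᶜ : Set E), f x.1 * Real.exp (-‖x.1‖ ^ 2) ∂(μ.comap (↑)) := by
      rw [integral_subtype_comap (measurableSet_singleton _).compl
        fun x ↦ f x * Real.exp (-‖x‖ ^ 2), restrict_compl_singleton]
    _ = ∫ x, f x.1 * (x.2.1 ^ q * Real.exp (-x.2.1 ^ 2))
          ∂μ.toSphere.prod (.volumeIoiPow (d - 1)) := by
      rw [← μ.measurePreserving_homeomorphUnitSphereProd.integral_comp
        (Homeomorph.measurableEmbedding _)]
      refine integral_congr_ae (.of_forall fun x ↦ ?_)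
      have hx : 0 < ‖x.1‖ := norm_pos_iff.2 x.2
      have := hf ‖x.1‖ hx (‖x.1‖⁻¹ • x.1)
      rw [smul_smul, mul_inv_cancel₀ hx.ne', one_smul] at this
      simp only [homeomorphUnitSphereProd_apply_fst_coe, homeomorphUnitSphereProd_apply_snd_coe]
      rw [this]
      ring
    _ = (∫ x : Metric.sphere (0 : E) 1, f x ∂μ.toSphere) *
          ∫ x : Ioi (0 : ℝ), x.1 ^ q * Real.exp (-x.1 ^ 2) ∂.volumeIoiPow (d - 1) :=
      integral_prod_mul (fun x : Metric.sphere (0 : E) 1 ↦ f x)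
        fun x : Ioi (0 : ℝ) ↦ x.1 ^ q * Real.exp (-x.1 ^ 2)
    _ = _ := by
      congr 1
      simp only [Measure.volumeIoiPow, ENNReal.ofReal]
      rw [integral_withDensity_eq_integral_smul,
        integral_subtype_comap measurableSet_Ioi
          fun a : ℝ ↦ Real.toNNReal (a ^ (d - 1)) • (a ^ q * Real.exp (-a ^ 2))]
      · have := integral_rpow_mul_exp_neg_rpow (p := 2) (q := (d - 1 + q : ℕ)) two_pos
          (by linarith [(d - 1 + q).cast_nonneg (α := ℝ)])
        rw [show (((d - 1 + q : ℕ) : ℝ) + 1) / 2 = (d + q) / 2 by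
          push_cast [Nat.cast_sub hd0]; ring] at this
        rw [div_eq_inv_mul, ← one_div, ← this]
        refine setIntegral_congr_fun measurableSet_Ioi fun x hx ↦ ?_
        simp only [NNReal.smul_def, Real.coe_toNNReal _ (pow_nonneg hx.out.le _), smul_eq_mul,
          Real.rpow_natCast, Real.rpow_two]
        ring
      · exact (measurable_subtype_coe.pow_const _).real_toNNReal

theorem integral_cos_natCast_mul_sq {k : ℕ} (hk : k ≠ 0) :
    ∫ θ in Set.Ioo (-Real.pi) Real.pi, Real.cos (k * θ) ^ 2 = Real.pi := by
  have hk' : (k : ℝ) ≠ 0 := Nat.cast_ne_zero.2 hk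
  rw [← integral_Ioc_eq_integral_Ioo, ← intervalIntegral.integral_of_le (by linarith [Real.pi_pos]),
    intervalIntegral.integral_comp_mul_left (fun θ ↦ Real.cos θ ^ 2) hk', integral_cos_sq]
  simp only [mul_neg, Real.sin_neg, Real.sin_nat_mul_pi, smul_eq_mul]
  field_simp
  ring

theorem integral_re_pow_sq_mul_exp {k : ℕ} (hk : k ≠ 0) :
    ∫ p : ℝ × ℝ, (((p.1 : ℂ) + (p.2 : ℂ) * I) ^ k).re ^ 2 * Real.exp (-(p.1 ^ 2 + p.2 ^ 2)) =
      Real.pi * (Real.Gamma (k + 1) / 2) := by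
  have hrad : ∫ r in Set.Ioi (0 : ℝ), r ^ (2 * k + 1) * Real.exp (-r ^ 2) =
      Real.Gamma (k + 1) / 2 := by
    have := integral_rpow_mul_exp_neg_rpow (p := 2) (q := (2 * k + 1 : ℕ)) two_pos
      (by linarith [(2 * k + 1).cast_nonneg (α := ℝ)])
    rw [show (((2 * k + 1 : ℕ) : ℝ) + 1) / 2 = k + 1 by push_cast; ring] at this
    rw [div_eq_inv_mul, ← one_div, ← this]
    simp only [Real.rpow_natCast, Real.rpow_two]
  have hprod := setIntegral_prod_mul (μ := volume) (ν := volume)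
    (fun r : ℝ ↦ r ^ (2 * k + 1) * Real.exp (-r ^ 2)) (fun θ : ℝ ↦ Real.cos (k * θ) ^ 2)
    (Set.Ioi 0) (Set.Ioo (-Real.pi) Real.pi)
  rw [hrad, integral_cos_natCast_mul_sq hk] at hprod
  rw [← integral_comp_polarCoord_symm, polarCoord_target, mul_comm, ← hprod,
    Measure.volume_eq_prod]
  refine setIntegral_congr_fun (measurableSet_Ioi.prod measurableSet_Ioo) fun p _ ↦ ?_
  have h1 : ((((p.1 * Real.cos p.2 : ℝ) : ℂ) + ((p.1 * Real.sin p.2 : ℝ) : ℂ) * I) ^ k) =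
      ((p.1 ^ k : ℝ) : ℂ) * Complex.exp ((k * p.2 : ℝ) * I) := by
    push_cast
    rw [mul_assoc, ← mul_add, mul_pow, ← Complex.exp_mul_I, ← Complex.exp_nat_mul, mul_assoc]
  have h2 : (p.1 * Real.cos p.2) ^ 2 + (p.1 * Real.sin p.2) ^ 2 = p.1 ^ 2 := by
    linear_combination p.1 ^ 2 * Real.sin_sq_add_cos_sq p.2
  simp only [polarCoord_symm_apply, smul_eq_mul]
  rw [h1, h2, Complex.re_ofReal_mul, Complex.exp_ofReal_mul_I_re]
  ring

/-- Splitting the first two coordinates off a Gaussian integral. -/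
theorem integral_first_two_mul_exp_neg_sq (m : ℕ) (g : ℝ → ℝ → ℝ) :
    ∫ x : EuclideanSpace ℝ (Fin (m + 1 + 1)), g (x 0) (x 1) * Real.exp (-‖x‖ ^ 2) =
      (∫ p : ℝ × ℝ, g p.1 p.2 * Real.exp (-(p.1 ^ 2 + p.2 ^ 2))) * √Real.pi ^ m := by
  have hG : ∫ y : Fin m → ℝ, ∏ i, Real.exp (-1 * y i ^ 2) = √Real.pi ^ m := by
    rw [integral_fintype_prod_volume_eq_pow fun t : ℝ ↦ Real.exp (-1 * t ^ 2), integral_gaussian]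
    simp
  let e1 := (MeasurableEquiv.piFinSuccAbove (fun _ : Fin (m + 1 + 1) ↦ ℝ) 0).symm
  let e2 := (MeasurableEquiv.piFinSuccAbove (fun _ : Fin (m + 1) ↦ ℝ) 0).symm
  let e : (ℝ × ℝ) × (Fin m → ℝ) ≃ᵐ EuclideanSpace ℝ (Fin (m + 1 + 1)) :=
    ((MeasurableEquiv.prodAssoc.trans ((MeasurableEquiv.refl ℝ).prodCongr e2)).trans e1).trans
      (MeasurableEquiv.toLp 2 _)
  have he1 : MeasurePreserving e1 := (volume_preserving_piFinSuccAbove _ 0).symm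
  have he2 : MeasurePreserving e2 := (volume_preserving_piFinSuccAbove _ 0).symm
  have he : MeasurePreserving e :=
    (PiLp.volume_preserving_toLp (Fin (m + 1 + 1))).comp (he1.comp
      (((MeasurePreserving.id (volume : Measure ℝ)).prod he2).comp
        (volume_preserving_prodAssoc (α₁ := ℝ) (β₁ := ℝ) (γ₁ := Fin m → ℝ))))
  have h0 (p) : e p 0 = p.1.1 := rfl
  have h1 (p) : e p 1 = p.1.2 := rfl
  have hs (p) (i : Fin m) : e p i.succ.succ = p.2 i := rfl
  rw [← he.integral_comp e.measurableEmbedding, ← hG, ← integral_prod_mul]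
  refine integral_congr_ae (.of_forall fun p ↦ ?_)
  simp only [EuclideanSpace.real_norm_sq_eq, Fin.sum_univ_succ, h0, hs, ← Real.exp_sum,
    mul_assoc, ← Real.exp_add, Fin.succ_zero_eq_one, h1]
  simp only [neg_mul, one_mul, Finset.sum_neg_distrib, neg_add, add_assoc]

theorem Gamma_add_natCast_eq_mul_prod {s : ℝ} (hs : 0 < s) (m : ℕ) :
    Real.Gamma (s + m) = Real.Gamma s * ∏ j ∈ Finset.range m, (s + j) := by
  induction m with
  | zero => simp
  | succ m ih =>
    rw [Finset.prod_range_succ, ← mul_assoc, ← ih, Nat.cast_succ, ← add_assoc,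
      Real.Gamma_add_one (by positivity), mul_comm]

/-- A positive sequence with a positive limit is bounded above and away from zero. -/
theorem exists_bounds_of_tendsto_pos {u : ℕ → ℝ} {l : ℝ} (hl : 0 < l)
    (hu : Filter.Tendsto u Filter.atTop (nhds l)) (hpos : ∀ k, 1 ≤ k → 0 < u k) :
    ∃ a b : ℝ, 0 < a ∧ 0 < b ∧ ∀ k, 1 ≤ k → a ≤ u k ∧ u k ≤ b := by
  have upper : ∀ {v : ℕ → ℝ} {l : ℝ}, Filter.Tendsto v Filter.atTop (nhds l) →
      ∃ b : ℝ, 0 < b ∧ ∀ k, v k ≤ b := fun hv ↦ by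
    obtain ⟨b, hb⟩ := hv.bddAbove_range
    exact ⟨max b 1, by positivity, fun k ↦ le_max_of_le_left (hb ⟨k, rfl⟩)⟩
  obtain ⟨b, hb, hub⟩ := upper hu
  obtain ⟨a, ha, hua⟩ := upper (hu.inv₀ hl.ne')
  exact ⟨a⁻¹, b, inv_pos.2 ha, hb, fun k hk ↦
    ⟨inv_le_of_inv_le₀ (hpos k hk) (hua k), hub k⟩⟩

/-- The squared `L²` norm of `Re ((x₀ + i x₁) ^ k)` on the sphere, as a ratio of Gamma values. -/
theorem integral_sphere_re_pow_sq (m : ℕ) {k : ℕ} (hk : k ≠ 0) :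
    ∫ x : Metric.sphere (0 : EuclideanSpace ℝ (Fin (m + 1 + 1))) 1,
        ((((x : EuclideanSpace ℝ (Fin (m + 1 + 1))) 0 : ℂ) +
          ((x : EuclideanSpace ℝ (Fin (m + 1 + 1))) 1 : ℂ) * I) ^ k).re ^ 2
        ∂((volume : Measure (EuclideanSpace ℝ (Fin (m + 1 + 1)))).toSphere) =
      Real.pi * √Real.pi ^ m * (Real.Gamma (k + 1) / Real.Gamma (m / 2 + (k + 1 : ℕ))) := by
  have h1 := integral_homogeneous_mul_exp_neg_sq
    (volume : Measure (EuclideanSpace ℝ (Fin (m + 1 + 1))))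
    (fun x ↦ (((x 0 : ℂ) + (x 1 : ℂ) * I) ^ k).re ^ 2) (2 * k) (fun r _ x ↦ by
      have : ((r • x) 0 : ℂ) + ((r • x) 1 : ℂ) * I = r * ((x 0 : ℂ) + (x 1 : ℂ) * I) := by
        simp only [PiLp.smul_apply, smul_eq_mul]
        push_cast
        ring
      rw [this, mul_pow, ← Complex.ofReal_pow, Complex.re_ofReal_mul]
      ring)
  have h2 := integral_first_two_mul_exp_neg_sq m
    fun a b ↦ (((a : ℂ) + (b : ℂ) * I) ^ k).re ^ 2
  have hΓ : 0 < Real.Gamma (m / 2 + (k + 1 : ℕ)) := Real.Gamma_pos_of_pos (by positivity)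
  rw [integral_re_pow_sq_mul_exp hk, h1, finrank_euclideanSpace_fin,
    show (((m + 1 + 1 : ℕ) : ℝ) + (2 * k : ℕ)) / 2 = m / 2 + (k + 1 : ℕ) by push_cast; ring] at h2
  rw [← mul_div_assoc, eq_div_iff hΓ.ne']
  linarith

theorem tendsto_rpow_mul_Gamma_div_Gamma {s : ℝ} (hs : 0 < s) :
    Filter.Tendsto
      (fun k : ℕ ↦ (k : ℝ) ^ s * (Real.Gamma (k + 1) / Real.Gamma (s + (k + 1 : ℕ))))
      Filter.atTop (nhds 1) := by
  have hΓ := (Real.Gamma_pos_of_pos hs).ne'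
  have := (Real.GammaSeq_tendsto_Gamma s).div_const (Real.Gamma s)
  rw [div_self hΓ] at this
  refine this.congr fun k ↦ ?_
  rw [Gamma_add_natCast_eq_mul_prod hs, Real.Gamma_nat_eq_factorial, Real.GammaSeq]
  ring

/-- For `n ≥ 2` there are constants `c, C > 0` (depending only on `n`) such that
for every `k ≥ 1` the normalization constant
`c_k = (∫_{Sⁿ} (Re((x₁ + i x₂)^k))² dσ(x))^{-1/2}`
(which makes `Q_k = c_k · Re((x₁+ix₂)^k)` have `L²(Sⁿ)`-norm one) satisfies
`c * k^{(n-1)/4} ≤ c_k ≤ C * k^{(n-1)/4}`. -/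
theorem stmt3 (n : ℕ) (hn : 2 ≤ n) :
    ∃ c C : ℝ, 0 < c ∧ 0 < C ∧
      ∀ k : ℕ, 1 ≤ k →
        c * (k : ℝ) ^ (((n : ℝ) - 1) / 4) ≤
          (∫ x : Metric.sphere (0 : EuclideanSpace ℝ (Fin (n + 1))) 1,
              ((((x : EuclideanSpace ℝ (Fin (n + 1))) 0 : ℂ) +
                ((x : EuclideanSpace ℝ (Fin (n + 1))) 1 : ℂ) * Complex.I) ^ k).re ^ 2
              ∂((volume : Measure (EuclideanSpace ℝ (Fin (n + 1)))).toSphere)) ^ (-(1 : ℝ) / 2) ∧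
        (∫ x : Metric.sphere (0 : EuclideanSpace ℝ (Fin (n + 1))) 1,
              ((((x : EuclideanSpace ℝ (Fin (n + 1))) 0 : ℂ) +
                ((x : EuclideanSpace ℝ (Fin (n + 1))) 1 : ℂ) * Complex.I) ^ k).re ^ 2
              ∂((volume : Measure (EuclideanSpace ℝ (Fin (n + 1)))).toSphere)) ^ (-(1 : ℝ) / 2) ≤
          C * (k : ℝ) ^ (((n : ℝ) - 1) / 4) := by
  obtain ⟨m, rfl⟩ : ∃ m, n = m + 1 := ⟨n - 1, by omega⟩
  have hm : (0 : ℝ) < m := by exact_mod_cast (by omega : 0 < m)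
  set A : ℝ := Real.pi * √Real.pi ^ m
  have hA : 0 < A := by positivity
  set J : ℕ → ℝ := fun k ↦ A * (Real.Gamma (k + 1) / Real.Gamma (m / 2 + (k + 1 : ℕ))) with hJdef
  have hJ (k : ℕ) : 0 < J k := mul_pos hA (div_pos (Real.Gamma_pos_of_pos (by positivity))
    (Real.Gamma_pos_of_pos (by positivity)))
  have hk0 {k : ℕ} (hk : 1 ≤ k) : (0 : ℝ) < k := by exact_mod_cast hk
  have hlim : Filter.Tendsto (fun k : ℕ ↦ ((k : ℝ) ^ ((m : ℝ) / 2) * J k) ^ (-(1 : ℝ) / 2))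
      Filter.atTop (nhds (A ^ (-(1 : ℝ) / 2))) := by
    refine Filter.Tendsto.rpow_const ?_ (.inl hA.ne')
    have := (tendsto_rpow_mul_Gamma_div_Gamma (half_pos hm)).const_mul A
    rw [mul_one] at this
    exact this.congr fun k ↦ by simp only [hJdef]; ring
  obtain ⟨c, C, hc, hC, h⟩ := exists_bounds_of_tendsto_pos (Real.rpow_pos_of_pos hA _) hlim
    fun k hk ↦ Real.rpow_pos_of_pos (mul_pos (Real.rpow_pos_of_pos (hk0 hk) _) (hJ k)) _
  refine ⟨c, C, hc, hC, fun k hk ↦ ?_⟩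
  rw [integral_sphere_re_pow_sq m (by omega)]
  change c * _ ≤ J k ^ (-(1 : ℝ) / 2) ∧ J k ^ (-(1 : ℝ) / 2) ≤ C * _
  have hkpos := hk0 hk
  have hsplit : J k ^ (-(1 : ℝ) / 2) = ((k : ℝ) ^ ((m : ℝ) / 2) * J k) ^ (-(1 : ℝ) / 2) *
      (k : ℝ) ^ ((((m + 1 : ℕ) : ℝ) - 1) / 4) := by
    rw [Real.mul_rpow (by positivity) (hJ k).le, ← Real.rpow_mul hkpos.le, mul_right_comm,
      ← Real.rpow_add hkpos,
      show (m : ℝ) / 2 * (-1 / 2) + (((m + 1 : ℕ) : ℝ) - 1) / 4 = 0 by push_cast; ring,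
      Real.rpow_zero, one_mul]
  rw [hsplit]
  exact ⟨by gcongr; exact (h k hk).1, by gcongr; exact (h k hk).2⟩
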